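/- arXiv:1603.00311 — 3 statements merged into one kernel-verified Lean document; each statement's English description precedes it below -/
import Mathlib

section
/- Let n ≥ 2 and N ≥ 1, let c₁, c₂ ∈ ℝ^n be orthonormal vectors, and let ξ^{(1)},…,ξ^{(N)} be i.i.d. random vectors, each uniformly distributed on the closed unit Euclidean ball B^n ⊂ ℝ^n. Then the expected value of the empirical maximum η = max_{1≤i≤N} [(c₁ᵀξ^{(i)})² + (c₂ᵀξ^{(i)})²] equals E(η) = 1 − (2/n) B(2/n, N+1); equivalently, ∫₀¹ (1 − (1 − (1−x)^{n/2})^N) dx = 1 − (2/n) B(2/n, N+1). -/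
open MeasureTheory Matrix

/-- The uniform probability measure on the closed unit Euclidean ball in `ℝⁿ`. -/
noncomputable def unifBall (n : ℕ) : Measure (Fin n → ℝ) :=
  (volume {x : Fin n → ℝ | ∑ i, (x i) ^ 2 ≤ 1})⁻¹ •
    volume.restrict {x : Fin n → ℝ | ∑ i, (x i) ^ 2 ≤ 1}

/-- The Euler beta function `B(a,b) = Γ(a)Γ(b)/Γ(a+b)`. -/
noncomputable def betaFn (a b : ℝ) : ℝ :=
  Real.Gamma a * Real.Gamma b / Real.Gamma (a + b)

section Slices

section Measurability

variable {P Q : Type*} [NormedAddCommGroup P] [MeasurableSpace P] [BorelSpace P]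
  [NormedAddCommGroup Q] [MeasurableSpace Q] [BorelSpace Q]

theorem measurableSet_lt_norm_fst_sq (t : ℝ) :
    MeasurableSet {p : P × Q | t < ‖p.1‖ ^ 2 ∧ ‖p.1‖ ^ 2 + ‖p.2‖ ^ 2 ≤ 1} := by
  rw [Set.ofPred_and]
  exact (measurableSet_lt (by fun_prop) (by fun_prop)).inter
    (measurableSet_le (by fun_prop) (by fun_prop))

theorem measurableSet_norm_sq_add_norm_sq_le :
    MeasurableSet {p : P × Q | ‖p.1‖ ^ 2 + ‖p.2‖ ^ 2 ≤ 1} :=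
  measurableSet_le (by fun_prop) (by fun_prop)

end Measurability

variable {P Q : Type*} [NormedAddCommGroup P] [InnerProductSpace ℝ P] [FiniteDimensional ℝ P]
  [MeasurableSpace P] [BorelSpace P] [NormedAddCommGroup Q] [InnerProductSpace ℝ Q]
  [FiniteDimensional ℝ Q] [MeasurableSpace Q] [BorelSpace Q]

theorem volume_norm_sq_le (hP : Module.finrank ℝ P = 2) (s : ℝ) :
    volume {y : P | ‖y‖ ^ 2 ≤ s} = ENNReal.ofReal s * volume (Metric.ball (0 : P) 1) := by
  rcases lt_or_ge s 0 with hs | hs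
  · have : {y : P | ‖y‖ ^ 2 ≤ s} = ∅ := by
      ext y
      simpa using hs.trans_le (sq_nonneg _)
    rw [this, ENNReal.ofReal_of_nonpos hs.le]
    simp
  · have : {y : P | ‖y‖ ^ 2 ≤ s} = Metric.closedBall 0 (√s) := by
      ext y
      simp [Real.le_sqrt (norm_nonneg y) hs]
    rw [this, Measure.addHaar_closedBall _ _ (Real.sqrt_nonneg s), hP, Real.sq_sqrt hs]

theorem volume_lt_norm_sq_le (hP : Module.finrank ℝ P = 2) {t : ℝ} (ht : 0 ≤ t) (s : ℝ) :
    volume {y : P | t < ‖y‖ ^ 2 ∧ ‖y‖ ^ 2 ≤ s} =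
      ENNReal.ofReal (s - t) * volume (Metric.ball (0 : P) 1) := by
  rcases lt_or_ge s t with hs | hs
  · have : {y : P | t < ‖y‖ ^ 2 ∧ ‖y‖ ^ 2 ≤ s} = ∅ := by
      ext y
      simp only [Set.mem_ofPred_eq, Set.mem_empty_iff_false, iff_false]
      rintro ⟨h₁, h₂⟩
      linarith
    rw [this, ENNReal.ofReal_of_nonpos (by linarith)]
    simp
  · have : {y : P | t < ‖y‖ ^ 2 ∧ ‖y‖ ^ 2 ≤ s} = {y : P | ‖y‖ ^ 2 ≤ s} \ {y : P | ‖y‖ ^ 2 ≤ t} := by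
      ext y
      simp [and_comm]
    have hsub : {y : P | ‖y‖ ^ 2 ≤ t} ⊆ {y : P | ‖y‖ ^ 2 ≤ s} := fun y hy ↦ le_trans hy hs
    have hm : MeasurableSet {y : P | ‖y‖ ^ 2 ≤ t} := measurableSet_le (by fun_prop) (by fun_prop)
    rw [this, measure_sdiff hsub hm.nullMeasurableSet, volume_norm_sq_le hP,
      volume_norm_sq_le hP, ENNReal.ofReal_sub _ ht, ENNReal.sub_mul]
    · exact fun _ _ ↦ measure_ball_lt_top.ne
    · rw [volume_norm_sq_le hP]
      exact ENNReal.mul_ne_top ENNReal.ofReal_ne_top measure_ball_lt_top.ne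

theorem lintegral_ofReal_sub_norm_sq {s : ℝ} (hs : 0 < s) :
    ∫⁻ z : Q, ENNReal.ofReal (s - ‖z‖ ^ 2) =
      ENNReal.ofReal (s ^ (((2 + Module.finrank ℝ Q : ℕ) : ℝ) / 2)) *
        ∫⁻ z : Q, ENNReal.ofReal (1 - ‖z‖ ^ 2) := by
  have hr : 0 < √s := Real.sqrt_pos.2 hs
  have hmap := Measure.map_addHaar_smul (volume : Measure Q) (r := (√s)⁻¹) (by positivity)
  have h := congrArg (fun μ : Measure Q ↦ ∫⁻ z, ENNReal.ofReal (1 - ‖z‖ ^ 2) ∂μ) hmap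
  simp only [lintegral_smul_measure, smul_eq_mul] at h
  rw [lintegral_map (by fun_prop) (by fun_prop)] at h
  have hpow : s ^ (((2 + Module.finrank ℝ Q : ℕ) : ℝ) / 2) = s * √s ^ Module.finrank ℝ Q := by
    rw [Real.rpow_div_two_eq_sqrt _ hs.le, Real.rpow_natCast, pow_add, Real.sq_sqrt hs.le]
  have habs : |((√s)⁻¹ ^ Module.finrank ℝ Q)⁻¹| = √s ^ Module.finrank ℝ Q := by
    rw [inv_pow, inv_inv, abs_of_pos (by positivity)]
  rw [habs] at h
  rw [hpow, ENNReal.ofReal_mul hs.le, mul_assoc, ← h, ← lintegral_const_mul _ (by fun_prop)]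
  refine lintegral_congr fun z ↦ ?_
  rw [← ENNReal.ofReal_mul hs.le, norm_smul, mul_pow, norm_inv, Real.norm_of_nonneg hr.le, inv_pow,
    Real.sq_sqrt hs.le]
  congr 1
  field_simp

theorem volume_lt_norm_fst_sq (hP : Module.finrank ℝ P = 2) {t : ℝ} (ht : 0 ≤ t) :
    volume {p : P × Q | t < ‖p.1‖ ^ 2 ∧ ‖p.1‖ ^ 2 + ‖p.2‖ ^ 2 ≤ 1} =
      (∫⁻ z : Q, ENNReal.ofReal (1 - t - ‖z‖ ^ 2)) * volume (Metric.ball (0 : P) 1) := by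
  rw [Measure.volume_eq_prod, Measure.prod_apply_symm (measurableSet_lt_norm_fst_sq t),
    ← lintegral_mul_const _ (by fun_prop)]
  refine lintegral_congr fun z ↦ ?_
  rw [sub_right_comm, ← volume_lt_norm_sq_le hP ht]
  congr 1
  ext y
  simp [le_sub_iff_add_le]

theorem volume_norm_sq_add_norm_sq_le (hP : Module.finrank ℝ P = 2) :
    volume {p : P × Q | ‖p.1‖ ^ 2 + ‖p.2‖ ^ 2 ≤ 1} =
      (∫⁻ z : Q, ENNReal.ofReal (1 - ‖z‖ ^ 2)) * volume (Metric.ball (0 : P) 1) := by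
  rw [Measure.volume_eq_prod, Measure.prod_apply_symm measurableSet_norm_sq_add_norm_sq_le,
    ← lintegral_mul_const _ (by fun_prop)]
  refine lintegral_congr fun z ↦ ?_
  rw [← volume_norm_sq_le hP]
  congr 1
  ext y
  simp [le_sub_iff_add_le]

theorem volume_lt_norm_fst_sq_eq_mul (hP : Module.finrank ℝ P = 2) {t : ℝ} (ht : 0 ≤ t) :
    volume {p : P × Q | t < ‖p.1‖ ^ 2 ∧ ‖p.1‖ ^ 2 + ‖p.2‖ ^ 2 ≤ 1} =
      (if t < 1 then ENNReal.ofReal ((1 - t) ^ (((2 + Module.finrank ℝ Q : ℕ) : ℝ) / 2)) else 0) *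
        volume {p : P × Q | ‖p.1‖ ^ 2 + ‖p.2‖ ^ 2 ≤ 1} := by
  rw [volume_lt_norm_fst_sq hP ht, volume_norm_sq_add_norm_sq_le hP, ← mul_assoc]
  congr 1
  split_ifs with h
  · exact lintegral_ofReal_sub_norm_sq (by linarith)
  · rw [zero_mul, lintegral_eq_zero_iff (by fun_prop)]
    refine .of_forall fun z ↦ ENNReal.ofReal_of_nonpos ?_
    nlinarith [sq_nonneg ‖z‖]

end Slices

theorem measurableSet_sum_sq_le_one (n : ℕ) :
    MeasurableSet {x : Fin n → ℝ | ∑ i, (x i) ^ 2 ≤ 1} :=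
  measurableSet_le (by fun_prop) (by fun_prop)

theorem setOf_sum_sq_le_one_eq (n : ℕ) :
    {x : Fin n → ℝ | ∑ i, (x i) ^ 2 ≤ 1} =
      WithLp.toLp 2 ⁻¹' Metric.closedBall (0 : EuclideanSpace ℝ (Fin n)) 1 := by
  ext x
  rw [Set.mem_preimage, mem_closedBall_zero_iff, ← sq_le_one_iff₀ (norm_nonneg _),
    EuclideanSpace.real_norm_sq_eq]
  rfl

theorem volume_sum_sq_le_one_ne_zero (n : ℕ) :
    volume {x : Fin n → ℝ | ∑ i, (x i) ^ 2 ≤ 1} ≠ 0 := by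
  rw [setOf_sum_sq_le_one_eq, (PiLp.volume_preserving_toLp _).measure_preimage
    Metric.isClosed_closedBall.measurableSet.nullMeasurableSet]
  exact (Metric.measure_closedBall_pos _ _ one_pos).ne'

theorem volume_sum_sq_le_one_ne_top (n : ℕ) :
    volume {x : Fin n → ℝ | ∑ i, (x i) ^ 2 ≤ 1} ≠ ⊤ := by
  rw [setOf_sum_sq_le_one_eq, (PiLp.volume_preserving_toLp _).measure_preimage
    Metric.isClosed_closedBall.measurableSet.nullMeasurableSet]
  exact measure_closedBall_lt_top.ne

instance isProbabilityMeasure_unifBall (n : ℕ) : IsProbabilityMeasure (unifBall n) where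
  measure_univ := by
    simp only [unifBall, Measure.smul_apply, Measure.restrict_apply_univ, smul_eq_mul]
    exact ENNReal.inv_mul_cancel (volume_sum_sq_le_one_ne_zero n) (volume_sum_sq_le_one_ne_top n)

theorem exists_measurePreserving_prod {n m : ℕ} (hnm : n = 2 + m) {c₁ c₂ : Fin n → ℝ}
    (hc₁ : ∑ i, (c₁ i) ^ 2 = 1) (hc₂ : ∑ i, (c₂ i) ^ 2 = 1) (hortho : c₁ ⬝ᵥ c₂ = 0) :
    ∃ f : (Fin n → ℝ) → EuclideanSpace ℝ (Fin 2) × EuclideanSpace ℝ (Fin m),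
      MeasurePreserving f ∧ (∀ x, ‖(f x).1‖ ^ 2 = (c₁ ⬝ᵥ x) ^ 2 + (c₂ ⬝ᵥ x) ^ 2) ∧
        ∀ x, ‖(f x).1‖ ^ 2 + ‖(f x).2‖ ^ 2 = ∑ i, (x i) ^ 2 := by
  let v : Fin 2 ⊕ Fin m → EuclideanSpace ℝ (Fin n) :=
    Sum.elim ![WithLp.toLp 2 c₁, WithLp.toLp 2 c₂] 0
  have hv : Orthonormal ℝ ((Set.range Sum.inl).domRestrict v) := by
    rw [orthonormal_iff_ite]
    rintro ⟨_, i, rfl⟩ ⟨_, j, rfl⟩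
    have h₁ : c₁ ⬝ᵥ c₁ = 1 := by simpa [dotProduct, ← sq]
    have h₂ : c₂ ⬝ᵥ c₂ = 1 := by simpa [dotProduct, ← sq]
    fin_cases i <;> fin_cases j <;>
      simp [v, Set.domRestrict, EuclideanSpace.inner_toLp_toLp, dotProduct_comm c₂ c₁, hortho, h₁,
        h₂, -inner_self_eq_norm_sq_to_K]
  obtain ⟨b, hb⟩ := hv.exists_orthonormalBasis_extension_of_card_eq (by simp [hnm])
  let e := b.repr.trans (PiLp.sumPiLpEquivProdLpPiLp 2 (fun _ : Fin 2 ⊕ Fin m ↦ ℝ))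
  refine ⟨fun x ↦ WithLp.ofLp (e (WithLp.toLp 2 x)), ?_, fun x ↦ ?_, fun x ↦ ?_⟩
  · exact (WithLp.volume_preserving_ofLp _ _).comp
      (e.measurePreserving.comp (PiLp.volume_preserving_toLp _))
  · have h (i : Fin 2) : (e (WithLp.toLp 2 x)).fst i = inner ℝ (v (.inl i)) (WithLp.toLp 2 x) := by
      rw [← hb _ ⟨i, rfl⟩, ← b.repr_apply_apply]
      rfl
    rw [EuclideanSpace.real_norm_sq_eq, Fin.sum_univ_two]
    change (e (WithLp.toLp 2 x)).fst 0 ^ 2 + (e (WithLp.toLp 2 x)).fst 1 ^ 2 = _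
    rw [h, h]
    simp [v, EuclideanSpace.inner_toLp_toLp, dotProduct_comm]
  · have h := WithLp.prod_norm_sq_eq_of_L2 (e (WithLp.toLp 2 x))
    rw [e.norm_map, EuclideanSpace.real_norm_sq_eq] at h
    exact h.symm

theorem unifBall_lt {n : ℕ} (hn : 2 ≤ n) {c₁ c₂ : Fin n → ℝ}
    (hc₁ : ∑ i, (c₁ i) ^ 2 = 1) (hc₂ : ∑ i, (c₂ i) ^ 2 = 1) (hortho : c₁ ⬝ᵥ c₂ = 0)
    {t : ℝ} (ht : 0 ≤ t) :
    unifBall n {x | t < (c₁ ⬝ᵥ x) ^ 2 + (c₂ ⬝ᵥ x) ^ 2} =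
      if t < 1 then ENNReal.ofReal ((1 - t) ^ ((n : ℝ) / 2)) else 0 := by
  obtain ⟨m, rfl⟩ := Nat.exists_eq_add_of_le hn
  obtain ⟨f, hf, hf₁, hf₂⟩ := exists_measurePreserving_prod rfl hc₁ hc₂ hortho
  have h := volume_lt_norm_fst_sq_eq_mul (P := EuclideanSpace ℝ (Fin 2))
    (Q := EuclideanSpace ℝ (Fin m)) (by simp) ht
  rw [← hf.measure_preimage (measurableSet_lt_norm_fst_sq t).nullMeasurableSet,
    ← hf.measure_preimage measurableSet_norm_sq_add_norm_sq_le.nullMeasurableSet] at h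
  simp only [Set.preimage_ofPred_eq, hf₂, finrank_euclideanSpace, Fintype.card_fin] at h
  simp only [hf₁] at h
  rw [unifBall, Measure.smul_apply, Measure.restrict_apply' (measurableSet_sum_sq_le_one _),
    smul_eq_mul, ← Set.ofPred_and, h, mul_comm, mul_assoc, ENNReal.mul_inv_cancel
      (volume_sum_sq_le_one_ne_zero _) (volume_sum_sq_le_one_ne_top _), mul_one]

theorem integral_one_sub_rpow_pow {a : ℝ} (ha : 0 < a) (N : ℕ) :
    ∫ u in (0 : ℝ)..1, (1 - u ^ a) ^ N = a⁻¹ * betaFn a⁻¹ ((N : ℝ) + 1) := by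
  have hbeta : betaFn a⁻¹ ((N : ℝ) + 1) = ∫ x in (0 : ℝ)..1, x ^ (a⁻¹ - 1) * (1 - x) ^ N := by
    change ProbabilityTheory.beta _ _ = _
    rw [ProbabilityTheory.beta_eq_betaIntegralReal _ _ (by positivity) (by positivity),
      Complex.betaIntegral]
    rw [← Complex.ofReal_re (∫ x in (0 : ℝ)..1, x ^ (a⁻¹ - 1) * (1 - x) ^ N),
      ← intervalIntegral.integral_ofReal]
    congr 1
    refine intervalIntegral.integral_congr fun x hx ↦ ?_
    rw [Set.uIcc_of_le zero_le_one] at hx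
    simp [Complex.ofReal_cpow hx.1]
  have h := integral_comp_rpow_Ioi_of_pos (g := (Set.Ioc (0 : ℝ) 1).indicator
    fun u ↦ (1 - u ^ a) ^ N) (inv_pos.2 ha)
  rw [hbeta, intervalIntegral.integral_of_le zero_le_one, intervalIntegral.integral_of_le zero_le_one,
    ← integral_const_mul]
  rw [setIntegral_indicator measurableSet_Ioc, Set.inter_eq_right.2 Set.Ioc_subset_Ioi_self] at h
  have hinter : Set.Ioc (0 : ℝ) 1 = Set.Ioi 0 ∩ Set.Ioc 0 1 :=
    (Set.inter_eq_right.2 Set.Ioc_subset_Ioi_self).symm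
  rw [← h]
  conv_rhs => rw [hinter, ← setIntegral_indicator measurableSet_Ioc]
  refine setIntegral_congr_fun measurableSet_Ioi fun x (hx : 0 < x) ↦ ?_
  have hiff : x ^ a⁻¹ ≤ 1 ↔ x ≤ 1 := by
    rw [Real.rpow_inv_le_iff_of_pos hx.le zero_le_one ha, Real.one_rpow]
  by_cases hx1 : x ≤ 1
  · rw [Set.indicator_of_mem (show x ^ a⁻¹ ∈ Set.Ioc (0 : ℝ) 1 from ⟨by positivity, hiff.2 hx1⟩),
      Set.indicator_of_mem (show x ∈ Set.Ioc (0 : ℝ) 1 from ⟨hx, hx1⟩), Real.rpow_inv_rpow hx.le ha.ne']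
    simp [mul_assoc]
  · rw [Set.indicator_of_notMem (fun h ↦ hx1 (hiff.1 h.2)), Set.indicator_of_notMem fun h ↦ hx1 h.2]
    simp

theorem integral_one_sub_one_sub_rpow_pow {a : ℝ} (ha : 0 < a) (N : ℕ) :
    ∫ x in (0 : ℝ)..1, (1 - (1 - (1 - x) ^ a) ^ N) = 1 - a⁻¹ * betaFn a⁻¹ ((N : ℝ) + 1) := by
  rw [intervalIntegral.integral_comp_sub_left (fun u ↦ 1 - (1 - u ^ a) ^ N) 1, sub_self, sub_zero,
    intervalIntegral.integral_sub (by simp), integral_one_sub_rpow_pow ha]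
  · simp
  · exact Continuous.intervalIntegrable
      (by have := Real.continuous_rpow_const ha.le; fun_prop) _ _

/-- The tail of the maximum of independent samples. -/
theorem measureReal_pi_lt_iSup {Ω : Type*} [MeasurableSpace Ω] (μ : Measure Ω)
    [IsProbabilityMeasure μ] {X : Ω → ℝ} (hX : Measurable X) {N : ℕ} (hN : 1 ≤ N) (t : ℝ) :
    (Measure.pi fun _ : Fin N ↦ μ).real {ξ | t < ⨆ i, X (ξ i)} =
      1 - (1 - μ.real {x | t < X x}) ^ N := by
  have : Nonempty (Fin N) := ⟨⟨0, hN⟩⟩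
  have hset : {ξ : Fin N → Ω | t < ⨆ i, X (ξ i)} =
      (Set.univ.pi fun _ ↦ {x | t < X x}ᶜ)ᶜ := by
    ext ξ
    simp only [Set.mem_ofPred_eq, Set.mem_compl_iff, Set.mem_univ_pi]
    rw [← not_le, ciSup_le_iff (Finite.bddAbove_range _)]
    simp
  have hmeas : MeasurableSet {x | t < X x} := measurableSet_lt measurable_const hX
  rw [hset, probReal_compl_eq_one_sub (.univ_pi fun _ ↦ hmeas.compl), measureReal_def,
    Measure.pi_pi, ENNReal.toReal_prod]
  simp [← measureReal_def, probReal_compl_eq_one_sub hmeas]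

/-- Theorem 4 (expectation): for orthonormal `c₁, c₂ ∈ ℝⁿ` and `N` i.i.d. samples uniform
on the unit Euclidean ball, the empirical maximum `η = maxᵢ ((c₁ᵀξ⁽ⁱ⁾)² + (c₂ᵀξ⁽ⁱ⁾)²)`
satisfies `E(η) = 1 - (2/n) B(2/n, N+1)`; equivalently
`∫₀¹ (1 - (1-(1-x)^(n/2))^N) dx = 1 - (2/n) B(2/n, N+1)`. -/
theorem stmt_11 (n N : ℕ) (hn : 2 ≤ n) (hN : 1 ≤ N) (c₁ c₂ : Fin n → ℝ)
    (hc₁ : ∑ i, (c₁ i) ^ 2 = 1) (hc₂ : ∑ i, (c₂ i) ^ 2 = 1)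
    (hortho : c₁ ⬝ᵥ c₂ = 0) :
    (∫ ξ : Fin N → Fin n → ℝ,
        (⨆ i : Fin N, ((c₁ ⬝ᵥ ξ i) ^ 2 + (c₂ ⬝ᵥ ξ i) ^ 2))
        ∂(Measure.pi fun _ : Fin N => unifBall n)) =
      1 - 2 / (n : ℝ) * betaFn (2 / (n : ℝ)) ((N : ℝ) + 1) ∧
    (∫ x in (0 : ℝ)..1, (1 - (1 - (1 - x) ^ ((n : ℝ) / 2)) ^ N)) =
      1 - 2 / (n : ℝ) * betaFn (2 / (n : ℝ)) ((N : ℝ) + 1) := by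
  have hint : (∫ x in (0 : ℝ)..1, (1 - (1 - (1 - x) ^ ((n : ℝ) / 2)) ^ N)) =
      1 - 2 / (n : ℝ) * betaFn (2 / (n : ℝ)) ((N : ℝ) + 1) := by
    rw [integral_one_sub_one_sub_rpow_pow (by positivity), inv_div]
  refine ⟨?_, hint⟩
  rw [← hint]
  have hX : Measurable fun x : Fin n → ℝ ↦ (c₁ ⬝ᵥ x) ^ 2 + (c₂ ⬝ᵥ x) ^ 2 := by
    unfold dotProduct
    fun_prop
  have htail {t : ℝ} (ht : 0 ≤ t) :
      (Measure.pi fun _ : Fin N ↦ unifBall n).real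
        {ξ | t < ⨆ i, ((c₁ ⬝ᵥ ξ i) ^ 2 + (c₂ ⬝ᵥ ξ i) ^ 2)} =
      (Set.Iio 1).indicator (fun x ↦ 1 - (1 - (1 - x) ^ ((n : ℝ) / 2)) ^ N) t := by
    rw [measureReal_pi_lt_iSup _ hX hN, measureReal_def, unifBall_lt hn hc₁ hc₂ hortho ht]
    by_cases h : t < 1
    · simp [h, Real.rpow_nonneg (sub_nonneg.2 h.le)]
    · simp [h]
  have hnonneg (ξ : Fin N → Fin n → ℝ) :
      0 ≤ ⨆ i, ((c₁ ⬝ᵥ ξ i) ^ 2 + (c₂ ⬝ᵥ ξ i) ^ 2) :=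
    Real.iSup_nonneg fun i ↦ by positivity
  have hle : ∀ᵐ ξ ∂(Measure.pi fun _ : Fin N ↦ unifBall n),
      ‖⨆ i, ((c₁ ⬝ᵥ ξ i) ^ 2 + (c₂ ⬝ᵥ ξ i) ^ 2)‖ ≤ 1 := by
    have h := htail zero_le_one
    rw [Set.indicator_of_notMem (by simp), measureReal_eq_zero_iff] at h
    rw [ae_iff]
    convert h using 4 with ξ
    rw [Real.norm_of_nonneg (hnonneg ξ), not_le]
  have hintegrable : Integrable
      (fun ξ : Fin N → Fin n → ℝ ↦ ⨆ i, ((c₁ ⬝ᵥ ξ i) ^ 2 + (c₂ ⬝ᵥ ξ i) ^ 2))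
      (Measure.pi fun _ ↦ unifBall n) :=
    .of_bound (Measurable.iSup fun i ↦ hX.comp (measurable_pi_apply i)).aestronglyMeasurable 1 hle
  rw [hintegrable.integral_eq_integral_meas_lt (.of_forall hnonneg),
    setIntegral_congr_fun measurableSet_Ioi fun t ht ↦ htail (le_of_lt ht),
    setIntegral_indicator measurableSet_Iio, intervalIntegral.integral_of_le zero_le_one,
    Set.Ioi_inter_Iio, integral_Ioc_eq_integral_Ioo]
end

section
/- Let n ≥ 1, p ∈ (0,1), 0 < δ ≤ 1/n, and let ξ^{(1)},…,ξ^{(N)} be i.i.d. random vectors, each uniformly distributed on the cube [−1,1]^n ⊂ ℝ^n, with η = max_{1≤i≤N} Σ_{j=1}^n ξ_j^{(i)}. Then P{η > n(1−δ)} ≥ p if and only if N ≥ ln(1−p) / ln(1 − n^n δ^n / (2^n n!)); i.e., the minimal sample size guaranteeing, with probability at least p, that the empirical maximum of g(x) = Σ_j x_j is a δ-accurate estimate of the true maximum n is N_min = ⌈ln(1−p) / ln(1 − n^n δ^n / (2^n n!))⌉. -/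
open MeasureTheory

/-- The uniform probability measure on the cube `[-1,1]ⁿ ⊂ ℝⁿ`. -/
noncomputable def unifCube (n : ℕ) : Measure (Fin n → ℝ) :=
  (volume {x : Fin n → ℝ | ∀ i, |x i| ≤ 1})⁻¹ •
    volume.restrict {x : Fin n → ℝ | ∀ i, |x i| ≤ 1}

/-- The corner simplex `{y ≥ 0, ∑ y < s}` in `ℝⁿ` has volume `sⁿ / n!`. -/
theorem volume_cornerSimplex (n : ℕ) {s : ℝ} (hs : 0 < s) :
    volume {y : Fin n → ℝ | (∀ i, 0 ≤ y i) ∧ ∑ i, y i < s} =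
      ENNReal.ofReal (s ^ n / n.factorial) := by
  induction n generalizing s with
  | zero => simp [hs, volume_pi]
  | succ n ih =>
    have hmeas : MeasurableSet {z : ℝ × (Fin n → ℝ) |
        0 ≤ z.1 ∧ (∀ i, 0 ≤ z.2 i) ∧ z.1 + ∑ i, z.2 i < s} := by
      measurability
    have hpre : {y : Fin (n + 1) → ℝ | (∀ i, 0 ≤ y i) ∧ ∑ i, y i < s} =
        MeasurableEquiv.piFinSuccAbove (fun _ => ℝ) 0 ⁻¹' {z : ℝ × (Fin n → ℝ) |
          0 ≤ z.1 ∧ (∀ i, 0 ≤ z.2 i) ∧ z.1 + ∑ i, z.2 i < s} := by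
      ext y
      simp [Fin.forall_fin_succ, Fin.sum_univ_succ, MeasurableEquiv.piFinSuccAbove,
        and_assoc, Fin.tail]
    rw [hpre, (volume_preserving_piFinSuccAbove (fun _ : Fin (n + 1) => ℝ) 0).measure_preimage
      hmeas.nullMeasurableSet, Measure.volume_eq_prod, Measure.prod_apply hmeas]
    have hslice (t : ℝ) : volume (Prod.mk t ⁻¹' {z : ℝ × (Fin n → ℝ) |
          0 ≤ z.1 ∧ (∀ i, 0 ≤ z.2 i) ∧ z.1 + ∑ i, z.2 i < s}) =
        (Set.Ico 0 s).indicator (fun t => ENNReal.ofReal ((s - t) ^ n / n.factorial)) t := by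
      by_cases ht : t ∈ Set.Ico 0 s
      · rw [Set.indicator_of_mem ht, ← ih (sub_pos.2 ht.2)]
        congr 1
        ext y
        simp [ht.1, lt_sub_iff_add_lt']
      · rw [Set.indicator_of_notMem ht]
        convert measure_empty (μ := volume)
        ext y
        simp only [Set.mem_preimage, Set.mem_ofPred_eq, Set.mem_empty_iff_false, iff_false]
        rintro ⟨h0, hy, hlt⟩
        exact ht ⟨h0, by linarith [Finset.sum_nonneg fun i (_ : i ∈ Finset.univ) => hy i]⟩
    simp_rw [hslice]
    have hcont : Continuous fun t : ℝ => (s - t) ^ n / (n.factorial : ℝ) := by fun_prop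
    rw [lintegral_indicator measurableSet_Ico, restrict_Ico_eq_restrict_Ioc,
      ← ofReal_integral_eq_lintegral_ofReal
        ((hcont.intervalIntegrable 0 s).1) ?_,
      ← intervalIntegral.integral_of_le hs.le, intervalIntegral.integral_div,
      intervalIntegral.integral_comp_sub_left (fun t => t ^ n), integral_pow]
    · congr 1
      rw [Nat.factorial_succ]
      push_cast
      field_simp
      simp
    · filter_upwards [ae_restrict_mem measurableSet_Ioc] with t ht
      have := sub_nonneg.2 ht.2
      simp only [Pi.zero_apply]
      positivity

/-- The cube `[-1,1]ⁿ` has volume `2ⁿ`. -/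
theorem volume_cube (n : ℕ) :
    volume {x : Fin n → ℝ | ∀ i, |x i| ≤ 1} = ENNReal.ofReal (2 ^ n) := by
  have : {x : Fin n → ℝ | ∀ i, |x i| ≤ 1} = Set.univ.pi fun _ => Set.Icc (-1) 1 := by
    ext x
    simp [abs_le, Pi.le_def, forall_and]
  rw [this, volume_pi_pi]
  norm_num [Real.volume_Icc]

instance isProbabilityMeasure_unifCube (n : ℕ) : IsProbabilityMeasure (unifCube n) where
  measure_univ := by
    rw [unifCube, Measure.smul_apply, Measure.restrict_apply_univ, smul_eq_mul, volume_cube]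
    exact ENNReal.inv_mul_cancel (by simp) (by simp)

/-- A cap of height `s ≤ 1` below the vertex `(1, …, 1)` of the cube is a corner simplex. -/
theorem unifCube_cap (n : ℕ) {s : ℝ} (hs : 0 < s) (hs1 : s ≤ 1) :
    unifCube n {x | n - s < ∑ j, x j} = ENNReal.ofReal (s ^ n / (2 ^ n * n.factorial)) := by
  have hcap : MeasurableSet {x : Fin n → ℝ | n - s < ∑ j, x j} := by measurability
  have hsimplex : MeasurableSet {y : Fin n → ℝ | (∀ i, 0 ≤ y i) ∧ ∑ i, y i < s} := by
    measurability
  have hinter : {x : Fin n → ℝ | n - s < ∑ j, x j} ∩ {x : Fin n → ℝ | ∀ i, |x i| ≤ 1} =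
      (fun x => 1 - x) ⁻¹' {y : Fin n → ℝ | (∀ i, 0 ≤ y i) ∧ ∑ i, y i < s} := by
    ext x
    simp only [Set.mem_inter_iff, Set.mem_ofPred_eq, Set.mem_preimage, Pi.sub_apply,
      Pi.one_apply, Finset.sum_sub_distrib, Finset.sum_const, Finset.card_univ,
      Fintype.card_fin, nsmul_eq_mul, mul_one, sub_nonneg]
    constructor
    · rintro ⟨h, hx⟩
      exact ⟨fun i => (abs_le.1 (hx i)).2, by linarith⟩
    · rintro ⟨hx, h⟩
      refine ⟨by linarith, fun i => abs_le.2 ⟨?_, hx i⟩⟩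
      have hle : 1 - x i ≤ ∑ j, (1 - x j) :=
        Finset.single_le_sum (f := fun j => 1 - x j) (fun j _ => sub_nonneg.2 (hx j))
          (Finset.mem_univ i)
      rw [Finset.sum_sub_distrib] at hle
      simp only [Finset.sum_const, Finset.card_univ, Fintype.card_fin, nsmul_eq_mul,
        mul_one] at hle
      linarith
  rw [unifCube, Measure.smul_apply, Measure.restrict_apply hcap, smul_eq_mul, volume_cube,
    hinter, ((volume : Measure (Fin n → ℝ)).measurePreserving_sub_left 1).measure_preimage
      hsimplex.nullMeasurableSet, volume_cornerSimplex n hs,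
    ← ENNReal.ofReal_inv_of_pos (by positivity), ← ENNReal.ofReal_mul (by positivity)]
  congr 1
  field_simp

/-- The maximum of `N` independent samples exceeds a nonnegative level `c` with probability
`1 - (1 - q) ^ N`, where `q` is the probability that a single sample does. For `N = 0` the real
supremum is `0`, whence the sign condition on `c`. -/
theorem pi_lt_iSup {α : Type*} [MeasurableSpace α] (μ : Measure α) [IsProbabilityMeasure μ]
    {f : α → ℝ} (hf : Measurable f) {c q : ℝ} (hc : 0 ≤ c) (hq : 0 ≤ q) (hq1 : q ≤ 1)
    (h : μ {x | c < f x} = ENNReal.ofReal q) (N : ℕ) :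
    Measure.pi (fun _ : Fin N => μ) {ξ | c < ⨆ i, f (ξ i)} =
      ENNReal.ofReal (1 - (1 - q) ^ N) := by
  have hset : MeasurableSet {x | c < f x} := measurableSet_lt measurable_const hf
  have hcompl : {ξ : Fin N → α | c < ⨆ i, f (ξ i)} =
      (Set.univ.pi fun _ => {x | c < f x}ᶜ)ᶜ := by
    ext ξ
    simp only [Set.mem_ofPred_eq, Set.mem_compl_iff, Set.mem_pi, Set.mem_univ, true_implies,
      not_lt]
    rw [← not_le, not_iff_not]
    exact ⟨fun hle i => (le_ciSup (Set.finite_range _).bddAbove i).trans hle,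
      fun hle => Real.iSup_le hle hc⟩
  rw [hcompl, prob_compl_eq_one_sub (MeasurableSet.univ_pi fun _ => hset.compl),
    Measure.pi_pi]
  simp only [prob_compl_eq_one_sub hset, h, Finset.prod_const, Finset.card_univ,
    Fintype.card_fin]
  rw [← ENNReal.ofReal_one, ← ENNReal.ofReal_sub _ hq, ← ENNReal.ofReal_pow (by linarith),
    ← ENNReal.ofReal_sub _ (by have := sub_nonneg.2 hq1; positivity)]

/-- The number of trials with success probability `q` needed to succeed at least once with
probability at least `p`. -/
theorem le_one_sub_pow_iff {p q : ℝ} (hp1 : p < 1) (hq : 0 < q) (hq1 : q < 1) (N : ℕ) :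
    p ≤ 1 - (1 - q) ^ N ↔ Real.log (1 - p) / Real.log (1 - q) ≤ N := by
  have hpos : 0 < 1 - q := by linarith
  rw [div_le_iff_of_neg (Real.log_neg hpos (by linarith)), ← Real.log_pow,
    Real.log_le_log_iff (by positivity) (by linarith)]
  constructor <;> intro h <;> linarith

/-- Theorem 5 (cube, diagonal direction, sample-size form): for `N` i.i.d. samples uniform
on `[-1,1]ⁿ` with `η = maxᵢ Σⱼ ξⱼ⁽ⁱ⁾`, one has `P{η > n(1-δ)} ≥ p` iff
`N ≥ ln(1-p)/ln(1 - nⁿδⁿ/(2ⁿ n!))`; in particular the minimal such sample size is the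
ceiling of that ratio. -/
theorem stmt_14 (n : ℕ) (hn : 1 ≤ n) (p δ : ℝ)
    (hp : p ∈ Set.Ioo (0 : ℝ) 1) (hδ0 : 0 < δ) (hδ : δ ≤ 1 / n) :
    (∀ N : ℕ,
      ENNReal.ofReal p ≤
          Measure.pi (fun _ : Fin N => unifCube n)
            {ξ : Fin N → Fin n → ℝ | (n : ℝ) * (1 - δ) < ⨆ i : Fin N, ∑ j, ξ i j} ↔
        Real.log (1 - p) /
            Real.log (1 - (n : ℝ) ^ n * δ ^ n / (2 ^ n * n.factorial)) ≤ (N : ℝ)) ∧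
    IsLeast
      {N : ℕ |
        ENNReal.ofReal p ≤
          Measure.pi (fun _ : Fin N => unifCube n)
            {ξ : Fin N → Fin n → ℝ | (n : ℝ) * (1 - δ) < ⨆ i : Fin N, ∑ j, ξ i j}}
      ⌈Real.log (1 - p) /
          Real.log (1 - (n : ℝ) ^ n * δ ^ n / (2 ^ n * n.factorial))⌉₊ := by
  have hn0 : (1 : ℝ) ≤ n := by exact_mod_cast hn
  have hs : 0 < n * δ := by positivity
  have hs1 : n * δ ≤ 1 := by rwa [le_div_iff₀' (by positivity)] at hδ
  have hq : 0 < (n : ℝ) ^ n * δ ^ n / (2 ^ n * n.factorial) := by positivity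
  have hq1 : (n : ℝ) ^ n * δ ^ n / (2 ^ n * n.factorial) < 1 := by
    rw [← mul_pow, div_lt_one (by positivity)]
    have h2 : (1 : ℝ) < 2 ^ n := one_lt_pow₀ one_lt_two (by lia)
    have hfac : (1 : ℝ) ≤ n.factorial := by exact_mod_cast n.factorial_pos
    have hpow : (n * δ) ^ n ≤ 1 := pow_le_one₀ hs.le hs1
    nlinarith
  have hcap := unifCube_cap n hs hs1
  rw [mul_pow, show (n : ℝ) - n * δ = n * (1 - δ) by ring] at hcap
  have key (N : ℕ) : ENNReal.ofReal p ≤ Measure.pi (fun _ : Fin N => unifCube n)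
        {ξ : Fin N → Fin n → ℝ | (n : ℝ) * (1 - δ) < ⨆ i : Fin N, ∑ j, ξ i j} ↔
      Real.log (1 - p) /
        Real.log (1 - (n : ℝ) ^ n * δ ^ n / (2 ^ n * n.factorial)) ≤ (N : ℝ) := by
    rw [pi_lt_iSup (unifCube n) (f := fun x => ∑ j, x j) (by fun_prop) (by linarith) hq.le
      hq1.le hcap, ENNReal.ofReal_le_ofReal_iff', ← le_one_sub_pow_iff hp.2 hq hq1]
    simp [hp.1.not_ge]
  refine ⟨key, (key _).2 (Nat.le_ceil _), fun N hN => Nat.ceil_le.2 ((key N).1 hN)⟩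
end

section
/- Let n ≥ 1, r > 0, 0 < h ≤ r, and let c ∈ ℝ^n with ‖c‖₂ = 1. If ξ is a random vector uniformly distributed on the closed Euclidean ball of radius r centered at the origin in ℝ^n, then the probability that ξ lies in the spherical cap C = {x : ‖x‖₂ ≤ r, cᵀx ≥ r − h} equals P{cᵀξ ≥ r − h} = (1/2) I((2rh − h²)/r²; (n+1)/2, 1/2); equivalently, the Lebesgue volume of C equals (1/2) I((2rh − h²)/r²; (n+1)/2, 1/2) times the volume of the ball of radius r. -/
open MeasureTheory Matrix

/-- The regularized incomplete beta function
`I(x; a, b) = (1 / B(a,b)) ∫₀ˣ t^(a-1) (1-t)^(b-1) dt`, `B(a,b) = Γ(a)Γ(b)/Γ(a+b)`. -/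
noncomputable def regIncBeta (x a b : ℝ) : ℝ :=
  (Real.Gamma (a + b) / (Real.Gamma a * Real.Gamma b)) *
    ∫ t in (0 : ℝ)..x, t ^ (a - 1) * (1 - t) ^ (b - 1)

open Set in
/-- The volume of a Euclidean ball, including dimension zero. -/
theorem volume_sum_sq_le (n : ℕ) {R : ℝ} (hR : 0 ≤ R) :
    volume {x : Fin n → ℝ | ∑ i, (x i) ^ 2 ≤ R} =
      ENNReal.ofReal (√R ^ n * (√Real.pi ^ n / Real.Gamma (n / 2 + 1))) := by
  rcases Nat.eq_zero_or_pos n with rfl | hn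
  · simp [hR, volume_pi]
  · have : Nonempty (Fin n) := ⟨⟨0, hn⟩⟩
    have h := EuclideanSpace.volume_closedBall (ι := Fin n) 0 (√R)
    rw [Fintype.card_fin, ← ENNReal.ofReal_pow (Real.sqrt_nonneg _),
      ← ENNReal.ofReal_mul (by positivity)] at h
    rw [← h, ← (PiLp.volume_preserving_toLp (Fin n)).measure_preimage
      Metric.isClosed_closedBall.measurableSet.nullMeasurableSet]
    congr 1
    ext x
    simp [EuclideanSpace.norm_eq, Real.sqrt_le_sqrt_iff hR]

theorem measurableSet_sum_sq_le_and_le {n : ℕ} (r a : ℝ) {f : (Fin n → ℝ) → ℝ}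
    (hf : Continuous f) :
    MeasurableSet {x : Fin n → ℝ | ∑ i, (x i) ^ 2 ≤ r ^ 2 ∧ a ≤ f x} := by
  have h1 : IsClosed {x : Fin n → ℝ | ∑ i, (x i) ^ 2 ≤ r ^ 2} :=
    isClosed_le (by fun_prop) (by fun_prop)
  have h2 : IsClosed {x : Fin n → ℝ | a ≤ f x} := isClosed_le (by fun_prop) hf
  convert (h1.inter h2).measurableSet using 1
  ext x
  simp

/-- Spherical caps with the same height have the same volume in all directions. -/
theorem volume_cap_eq_volume_cap_zero (m : ℕ) (r a : ℝ) (c : Fin (m + 1) → ℝ)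
    (hc : ∑ i, (c i) ^ 2 = 1) :
    volume {x : Fin (m + 1) → ℝ | ∑ i, (x i) ^ 2 ≤ r ^ 2 ∧ a ≤ c ⬝ᵥ x} =
      volume {x : Fin (m + 1) → ℝ | ∑ i, (x i) ^ 2 ≤ r ^ 2 ∧ a ≤ x 0} := by
  have horth : Orthonormal ℝ (({0} : Set (Fin (m + 1))).domRestrict
      (fun _ => (WithLp.toLp 2 c : EuclideanSpace ℝ (Fin (m + 1))))) := by
    refine ⟨fun i => ?_, fun i j hij => absurd (Subsingleton.elim i j) hij⟩
    simp [EuclideanSpace.norm_eq, Set.domRestrict, hc]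
  obtain ⟨b, hb⟩ := horth.exists_orthonormalBasis_extension_of_card_eq (by simp)
  have hb0 := hb 0 rfl
  have hpres := ((PiLp.volume_preserving_ofLp (Fin (m + 1))).comp
    b.measurePreserving_repr_symm).comp (PiLp.volume_preserving_toLp (Fin (m + 1)))
  rw [← hpres.measure_preimage]
  · congr 1
    ext y
    have hnorm : ∑ i, (b.repr.symm (WithLp.toLp 2 y) i) ^ 2 = ∑ i, (y i) ^ 2 := by
      have := b.repr.symm.norm_map (WithLp.toLp 2 y)
      have := congrArg (· ^ 2) this
      simpa only [EuclideanSpace.norm_sq_eq, Real.norm_eq_abs, sq_abs] using this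
    have hin : c ⬝ᵥ (b.repr.symm (WithLp.toLp 2 y)).ofLp = y 0 := by
      have h1 := b.repr_apply_apply (b.repr.symm (WithLp.toLp 2 y)) 0
      rw [hb0, LinearIsometryEquiv.apply_symm_apply] at h1
      rw [EuclideanSpace.inner_eq_star_dotProduct] at h1
      simp only [star_trivial] at h1
      rw [dotProduct_comm]
      exact h1.symm
    simp [hnorm, hin]
  · exact (measurableSet_sum_sq_le_and_le r a (by unfold dotProduct; fun_prop)).nullMeasurableSet

open Set in
/-- The volume of a spherical cap as an integral over slices. -/
theorem volume_cap_zero_eq_integral (m : ℕ) {r a : ℝ} (hr : 0 < r) (ha : 0 ≤ a) :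
    volume {x : Fin (m + 1) → ℝ | ∑ i, (x i) ^ 2 ≤ r ^ 2 ∧ a ≤ x 0} =
      ENNReal.ofReal (∫ s in Ioo a r,
        √(r ^ 2 - s ^ 2) ^ m * (√Real.pi ^ m / Real.Gamma (m / 2 + 1))) := by
  have hpres := (volume_preserving_piFinSuccAbove (fun _ : Fin (m + 1) => ℝ) 0).symm
  have hmeas : MeasurableSet {x : Fin (m + 1) → ℝ | ∑ i, (x i) ^ 2 ≤ r ^ 2 ∧ a ≤ x 0} :=
    measurableSet_sum_sq_le_and_le r a (by fun_prop)
  rw [← hpres.measure_preimage hmeas.nullMeasurableSet, Measure.volume_eq_prod,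
    Measure.prod_apply (hpres.measurable hmeas)]
  have hslice : ∀ s : ℝ, volume (Prod.mk s ⁻¹'
      ((MeasurableEquiv.piFinSuccAbove (fun _ : Fin (m + 1) => ℝ) 0).symm ⁻¹'
        {x : Fin (m + 1) → ℝ | ∑ i, (x i) ^ 2 ≤ r ^ 2 ∧ a ≤ x 0})) =
      (Icc a r).indicator (fun s => ENNReal.ofReal
        (√(r ^ 2 - s ^ 2) ^ m * (√Real.pi ^ m / Real.Gamma (m / 2 + 1)))) s := by
    intro s
    have hset : (Prod.mk s ⁻¹'
      ((MeasurableEquiv.piFinSuccAbove (fun _ : Fin (m + 1) => ℝ) 0).symm ⁻¹'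
        {x : Fin (m + 1) → ℝ | ∑ i, (x i) ^ 2 ≤ r ^ 2 ∧ a ≤ x 0})) =
        {y : Fin m → ℝ | ∑ i, (y i) ^ 2 ≤ r ^ 2 - s ^ 2 ∧ a ≤ s} := by
      ext y
      simp [MeasurableEquiv.piFinSuccAbove, Fin.sum_univ_succ, le_sub_iff_add_le']
    rw [hset]
    by_cases hs : s ∈ Icc a r
    · have : 0 ≤ r ^ 2 - s ^ 2 := by nlinarith [hs.1, hs.2]
      rw [indicator_of_mem hs, ← volume_sum_sq_le m this]
      simp [hs.1]
    · rw [indicator_of_notMem hs]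
      convert measure_empty (μ := (volume : Measure (Fin m → ℝ)))
      ext y
      simp only [mem_ofPred_eq, mem_empty_iff_false, iff_false, not_and]
      intro h1 h2
      have := Finset.sum_nonneg (fun i (_ : i ∈ Finset.univ) => sq_nonneg (y i))
      exact hs ⟨h2, by nlinarith⟩
  simp_rw [hslice]
  rw [lintegral_indicator measurableSet_Icc, setLIntegral_congr Ioo_ae_eq_Icc.symm,
    ofReal_integral_eq_lintegral_ofReal]
  · have : ContinuousOn (fun s : ℝ =>
        √(r ^ 2 - s ^ 2) ^ m * (√Real.pi ^ m / Real.Gamma (m / 2 + 1))) (Icc a r) := by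
      fun_prop
    exact (this.integrableOn_Icc).mono_set Ioo_subset_Icc_self
  · refine Filter.Eventually.of_forall fun s => ?_
    have := Real.Gamma_pos_of_pos (s := (m : ℝ) / 2 + 1) (by positivity)
    simp only [Pi.zero_apply]
    positivity

open Set in
/-- The substitution `t = 1 - s² / r²` in the incomplete beta integral. -/
theorem integral_incBeta_eq_integral_sqrt (m : ℕ) {r a : ℝ} (hr : 0 < r) (ha : 0 ≤ a)
    (har : a ≤ r) :
    ∫ t in (0 : ℝ)..(1 - a ^ 2 / r ^ 2), t ^ ((m : ℝ) / 2) * (1 - t) ^ (-(1 / 2) : ℝ) =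
      2 / r ^ (m + 1) * ∫ s in Ioo a r, √(r ^ 2 - s ^ 2) ^ m := by
  have himg : (fun s : ℝ => 1 - s ^ 2 / r ^ 2) '' Ioo a r = Ioo 0 (1 - a ^ 2 / r ^ 2) := by
    ext t
    simp only [mem_image, mem_Ioo]
    constructor
    · rintro ⟨s, ⟨h1, h2⟩, rfl⟩
      have hs : 0 ≤ s := by linarith
      constructor
      · rw [sub_pos, div_lt_one (by positivity)]
        gcongr
      · gcongr
    · rintro ⟨h1, h2⟩
      have h3 : a ^ 2 < r ^ 2 * (1 - t) := by
        have : a ^ 2 / r ^ 2 < 1 - t := by linarith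
        rwa [div_lt_iff₀' (by positivity)] at this
      have h4 : 0 ≤ r ^ 2 * (1 - t) := (sq_nonneg a).trans h3.le
      refine ⟨√(r ^ 2 * (1 - t)), ⟨Real.lt_sqrt_of_sq_lt h3, ?_⟩, ?_⟩
      · rw [Real.sqrt_lt' hr]
        nlinarith [pow_pos hr 2]
      · rw [Real.sq_sqrt h4]
        field_simp
        ring
  have h1 : 0 ≤ 1 - a ^ 2 / r ^ 2 := by
    rw [sub_nonneg, div_le_one (by positivity)]
    gcongr
  rw [intervalIntegral.integral_of_le h1, integral_Ioc_eq_integral_Ioo, ← himg,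
    integral_image_eq_integral_abs_deriv_smul (f' := fun s => -(2 * s / r ^ 2)) measurableSet_Ioo,
    ← integral_const_mul]
  · refine setIntegral_congr_fun measurableSet_Ioo fun s hs => ?_
    have hs0 : 0 < s := ha.trans_lt hs.1
    have hpos : 0 < r ^ 2 - s ^ 2 := by nlinarith [hs.2]
    have e1 : 1 - s ^ 2 / r ^ 2 = (√(r ^ 2 - s ^ 2) / r) ^ 2 := by
      rw [div_pow, Real.sq_sqrt hpos.le]
      field_simp
    have e2 : 1 - (1 - s ^ 2 / r ^ 2) = (s / r) ^ 2 := by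
      rw [div_pow]
      ring
    have e3 : ((√(r ^ 2 - s ^ 2) / r) ^ 2) ^ ((m : ℝ) / 2) = (√(r ^ 2 - s ^ 2) / r) ^ m := by
      rw [← Real.rpow_natCast _ 2, ← Real.rpow_mul (by positivity), ← Real.rpow_natCast _ m]
      congr 1
      push_cast
      ring
    have e4 : ((s / r) ^ 2) ^ (-(1 / 2) : ℝ) = (s / r)⁻¹ := by
      rw [← Real.rpow_natCast _ 2, ← Real.rpow_mul (by positivity), ← Real.rpow_neg_one]
      norm_num
    simp only [smul_eq_mul]
    rw [e2, e1, e3, e4, abs_neg, abs_of_pos (by positivity), div_pow]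
    field_simp
    ring
  · intro s _
    have h := ((hasDerivAt_pow 2 s).div_const (r ^ 2)).const_sub 1
    exact (by simpa using h : HasDerivAt _ _ s).hasDerivWithinAt
  · intro s hs u hu hsu
    have h2 : s ^ 2 = u ^ 2 := by
      have : s ^ 2 / r ^ 2 = u ^ 2 / r ^ 2 := by simpa using hsu
      rwa [div_left_inj' (by positivity)] at this
    exact (sq_eq_sq₀ (ha.trans hs.1.le) (ha.trans hu.1.le)).1 h2

/-- The volume of a spherical cap in terms of the volume of the ball. -/
theorem volume_cap_eq_regIncBeta_mul (n : ℕ) (hn : 1 ≤ n) (r h : ℝ) (hr : 0 < r) (hh0 : 0 < h)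
    (hhr : h ≤ r) (c : Fin n → ℝ) (hc : ∑ i, (c i) ^ 2 = 1) :
    volume {x : Fin n → ℝ | ∑ i, (x i) ^ 2 ≤ r ^ 2 ∧ r - h ≤ c ⬝ᵥ x} =
      ENNReal.ofReal
          (1 / 2 * regIncBeta ((2 * r * h - h ^ 2) / r ^ 2) (((n : ℝ) + 1) / 2) (1 / 2)) *
        volume {x : Fin n → ℝ | ∑ i, (x i) ^ 2 ≤ r ^ 2} := by
  obtain ⟨m, rfl⟩ := Nat.exists_eq_add_of_le' hn
  have hg1 := Real.Gamma_pos_of_pos (s := (m : ℝ) / 2 + 1) (by positivity)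
  have hg2 := Real.Gamma_pos_of_pos (s := ((m + 1 : ℕ) : ℝ) / 2 + 1) (by positivity)
  have hpi : 0 < √Real.pi := Real.sqrt_pos.2 Real.pi_pos
  have hx : (2 * r * h - h ^ 2) / r ^ 2 = 1 - (r - h) ^ 2 / r ^ 2 := by
    field_simp
    ring
  have ha : (((m + 1 : ℕ) : ℝ) + 1) / 2 - 1 = (m : ℝ) / 2 := by
    push_cast
    ring
  have ha' : (((m + 1 : ℕ) : ℝ) + 1) / 2 = (m : ℝ) / 2 + 1 := by
    push_cast
    ring
  have hab : (m : ℝ) / 2 + 1 + 1 / 2 = ((m + 1 : ℕ) : ℝ) / 2 + 1 := by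
    push_cast
    ring
  have hb : (1 / 2 - 1 : ℝ) = -(1 / 2) := by norm_num
  rw [volume_cap_eq_volume_cap_zero m r _ c hc, volume_cap_zero_eq_integral m hr (by linarith),
    volume_sum_sq_le _ (sq_nonneg r), ← ENNReal.ofReal_mul' (by positivity), regIncBeta, ha, hb,
    hx, integral_incBeta_eq_integral_sqrt m hr (by linarith) (by linarith), ha', hab,
    Real.Gamma_one_half_eq, integral_mul_const, Real.sqrt_sq hr.le]
  congr 1
  field_simp
  ring

/-- Spherical cap: for the uniform distribution on the closed Euclidean ball of radius `r`
in `ℝⁿ`, a unit vector `c` and `0 < h ≤ r`, the probability of the cap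
`{x : ‖x‖ ≤ r, cᵀx ≥ r-h}` equals `(1/2)·I((2rh-h²)/r²; (n+1)/2, 1/2)`; equivalently the
Lebesgue volume of the cap equals that number times the volume of the ball. -/
theorem stmt_18 (n : ℕ) (hn : 1 ≤ n) (r h : ℝ) (hr : 0 < r) (hh0 : 0 < h) (hhr : h ≤ r)
    (c : Fin n → ℝ) (hc : ∑ i, (c i) ^ 2 = 1) :
    ((volume {x : Fin n → ℝ | ∑ i, (x i) ^ 2 ≤ r ^ 2})⁻¹ •
        volume.restrict {x : Fin n → ℝ | ∑ i, (x i) ^ 2 ≤ r ^ 2})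
        {x : Fin n → ℝ | r - h ≤ c ⬝ᵥ x} =
      ENNReal.ofReal
        (1 / 2 * regIncBeta ((2 * r * h - h ^ 2) / r ^ 2) (((n : ℝ) + 1) / 2) (1 / 2)) ∧
    volume {x : Fin n → ℝ | ∑ i, (x i) ^ 2 ≤ r ^ 2 ∧ r - h ≤ c ⬝ᵥ x} =
      ENNReal.ofReal
          (1 / 2 * regIncBeta ((2 * r * h - h ^ 2) / r ^ 2) (((n : ℝ) + 1) / 2) (1 / 2)) *
        volume {x : Fin n → ℝ | ∑ i, (x i) ^ 2 ≤ r ^ 2} := by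
  have hcap := volume_cap_eq_regIncBeta_mul n hn r h hr hh0 hhr c hc
  refine ⟨?_, hcap⟩
  have hball := volume_sum_sq_le n (sq_nonneg r)
  have hpos : volume {x : Fin n → ℝ | ∑ i, (x i) ^ 2 ≤ r ^ 2} ≠ 0 := by
    have hg := Real.Gamma_pos_of_pos (s := (n : ℝ) / 2 + 1) (by positivity)
    have hpi : 0 < √Real.pi := Real.sqrt_pos.2 Real.pi_pos
    rw [hball, Real.sqrt_sq hr.le]
    exact (ENNReal.ofReal_pos.2 (by positivity)).ne'
  have hfin : volume {x : Fin n → ℝ | ∑ i, (x i) ^ 2 ≤ r ^ 2} ≠ ⊤ := by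
    rw [hball]
    exact ENNReal.ofReal_ne_top
  have hmeas : MeasurableSet {x : Fin n → ℝ | r - h ≤ c ⬝ᵥ x} :=
    (isClosed_le (by fun_prop) (by unfold dotProduct; fun_prop)).measurableSet
  have hinter : {x : Fin n → ℝ | r - h ≤ c ⬝ᵥ x} ∩ {x : Fin n → ℝ | ∑ i, (x i) ^ 2 ≤ r ^ 2} =
      {x : Fin n → ℝ | ∑ i, (x i) ^ 2 ≤ r ^ 2 ∧ r - h ≤ c ⬝ᵥ x} := by
    ext x
    exact and_comm
  rw [Measure.smul_apply, Measure.restrict_apply hmeas, hinter, hcap, smul_eq_mul, mul_comm,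
    mul_assoc, ENNReal.mul_inv_cancel hpos hfin, mul_one]
end
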